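/- Let k ≥ 0 be an integer. For every x ∈ [0,1], ∫_0^1 φ_k(|z−x|)·|z−x| dz ≤ (2/3)^{k+1} ∫_0^1 φ_k(|z−x|) dz. -/

import Mathlib

open MeasureTheory Finset

/-- `φ_k(y) = 1 - y ∑_{j<k} (-ln y)^j / j!` for `y ∈ (0,1]`, and `φ_k(0) = 1`. -/
noncomputable def phiUF (k : ℕ) (y : ℝ) : ℝ :=
  if y = 0 then 1
  else 1 - y * ∑ j ∈ Finset.range k, (-Real.log y) ^ j / (Nat.factorial j)

open Filter Topology in
theorem continuous_mul_neg_log_pow (j : ℕ) :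
    Continuous fun y : ℝ => y * (-Real.log y) ^ j := by
  rw [continuous_iff_continuousAt]
  intro y
  rcases eq_or_ne y 0 with rfl | hy
  · rw [continuousAt_iff_punctured_nhds, zero_mul]
    have hlog : Tendsto (fun y : ℝ => -Real.log y) (𝓝[≠] 0) atTop :=
      tendsto_neg_atBot_atTop.comp Real.tendsto_log_nhdsNE_zero
    refine tendsto_zero_iff_abs_tendsto_zero _ |>.2 ?_
    have h := ((Real.tendsto_pow_mul_exp_neg_atTop_nhds_zero j).comp hlog).abs
    rw [abs_zero] at h
    refine h.congr' ?_
    filter_upwards [self_mem_nhdsWithin] with z hz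
    simp only [Function.comp_apply, neg_neg, abs_mul, Real.exp_log_eq_abs hz, abs_abs, mul_comm]
  · have := Real.continuousAt_log hy
    fun_prop

theorem continuous_pow_succ_mul_neg_log_pow (m j : ℕ) :
    Continuous fun y : ℝ => y ^ (m + 1) * (-Real.log y) ^ j :=
  ((continuous_pow m).mul (continuous_mul_neg_log_pow j)).congr fun y => by
    simp only [Pi.mul_apply]
    ring

theorem integral_pow_succ_mul_neg_log_pow (m j : ℕ) :
    ∫ y in (0 : ℝ)..1, y ^ (m + 1) * (-Real.log y) ^ j
      = j.factorial / (m + 2 : ℝ) ^ (j + 1) := by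
  induction j with
  | zero =>
    simp only [pow_zero, mul_one, integral_pow]
    push_cast
    norm_num [add_assoc]
  | succ j ih =>
    have hderiv : ∀ y ∈ Set.Ioo (0 : ℝ) 1,
        HasDerivAt (fun y : ℝ => y ^ (m + 1 + 1) * (-Real.log y) ^ (j + 1))
          ((m + 2) * (y ^ (m + 1) * (-Real.log y) ^ (j + 1))
            - (j + 1) * (y ^ (m + 1) * (-Real.log y) ^ j)) y := by
      intro y hy
      have hy0 : y ≠ 0 := hy.1.ne'
      refine ((hasDerivAt_pow (m + 1 + 1) y).mul
        ((Real.hasDerivAt_log hy0).neg.pow (j + 1))).congr_deriv ?_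
      simp only [Pi.pow_apply, Pi.neg_apply, Nat.add_sub_cancel]
      push_cast
      field_simp
      ring
    have hint₁ := ((continuous_pow_succ_mul_neg_log_pow m (j + 1)).const_mul (m + 2 : ℝ)).intervalIntegrable (μ := volume) 0 1
    have hint₂ := ((continuous_pow_succ_mul_neg_log_pow m j).const_mul (j + 1 : ℝ)).intervalIntegrable (μ := volume) 0 1
    have h := intervalIntegral.integral_eq_sub_of_hasDerivAt_of_le zero_le_one
      (continuous_pow_succ_mul_neg_log_pow (m + 1) (j + 1)).continuousOn hderiv (hint₁.sub hint₂)
    rw [intervalIntegral.integral_sub hint₁ hint₂, intervalIntegral.integral_const_mul,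
      intervalIntegral.integral_const_mul, ih] at h
    simp only [Real.log_one, neg_zero, ne_eq, Nat.add_eq_zero_iff, one_ne_zero, and_false,
      not_false_eq_true, zero_pow, mul_zero, zero_mul, sub_self] at h
    rw [Nat.factorial_succ]
    push_cast
    rw [eq_div_iff (by positivity), pow_succ]
    field_simp at h
    linear_combination h

theorem phiUF_eq (k : ℕ) (y : ℝ) :
    phiUF k y = 1 - y * ∑ j ∈ Finset.range k, (-Real.log y) ^ j / (Nat.factorial j) := by
  unfold phiUF
  split_ifs with h <;> simp [h]

theorem phiUF_succ (k : ℕ) (y : ℝ) :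
    phiUF (k + 1) y = phiUF k y - y * (-Real.log y) ^ k / k.factorial := by
  simp only [phiUF_eq, Finset.sum_range_succ]
  ring

theorem continuous_phiUF (k : ℕ) : Continuous (phiUF k) := by
  induction k with
  | zero => exact (continuous_const (y := (1 : ℝ))).congr fun y => by simp [phiUF_eq]
  | succ k ih =>
    exact (ih.sub ((continuous_mul_neg_log_pow k).div_const _)).congr fun y =>
      (phiUF_succ k y).symm

theorem phiUF_nonneg (k : ℕ) {y : ℝ} (hy : y ∈ Set.Icc (0 : ℝ) 1) : 0 ≤ phiUF k y := by
  rw [phiUF_eq]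
  rcases hy.1.eq_or_lt with rfl | hpos
  · simp
  have h := mul_le_mul_of_nonneg_left
    (Real.sum_le_exp_of_nonneg (neg_nonneg.2 (Real.log_nonpos hy.1 hy.2)) k) hy.1
  rw [Real.exp_neg, Real.exp_log hpos, mul_inv_cancel₀ hpos.ne'] at h
  linarith

theorem integral_pow_mul_phiUF (m k : ℕ) :
    ∫ y in (0 : ℝ)..1, y ^ m * phiUF k y = 1 / ((m + 1) * (m + 2 : ℝ) ^ k) := by
  induction k with
  | zero => simp [phiUF_eq]
  | succ k ih =>
    have hsplit : ∀ y : ℝ, y ^ m * phiUF (k + 1) y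
        = y ^ m * phiUF k y - (y ^ (m + 1) * (-Real.log y) ^ k) / k.factorial := by
      intro y
      rw [phiUF_succ]
      ring
    have hint₁ : IntervalIntegrable (fun y => y ^ m * phiUF k y) volume 0 1 :=
      ((continuous_pow m).mul (continuous_phiUF k)).intervalIntegrable 0 1
    have hint₂ : IntervalIntegrable
        (fun y : ℝ => (y ^ (m + 1) * (-Real.log y) ^ k) / k.factorial) volume 0 1 :=
      ((continuous_pow_succ_mul_neg_log_pow m k).div_const _).intervalIntegrable 0 1
    simp only [hsplit]
    rw [intervalIntegral.integral_sub hint₁ hint₂, ih, intervalIntegral.integral_div,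
      integral_pow_succ_mul_neg_log_pow]
    have := Nat.factorial_ne_zero k
    field_simp
    ring

/-- The mean of a nonnegative weight on `[0, a]` is at most its mean `c` on `[0, 1]`. -/
theorem integral_mul_self_le_of_integral_mul_self_eq {f : ℝ → ℝ} (hf : Continuous f)
    (hnonneg : ∀ y ∈ Set.Icc (0 : ℝ) 1, 0 ≤ f y) {c : ℝ}
    (hc : ∫ y in (0 : ℝ)..1, f y * y = c * ∫ y in (0 : ℝ)..1, f y)
    {a : ℝ} (ha : a ∈ Set.Icc (0 : ℝ) 1) :
    ∫ y in (0 : ℝ)..a, f y * y ≤ c * ∫ y in (0 : ℝ)..a, f y := by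
  have hdiff : ∀ b : ℝ, ∫ y in (0 : ℝ)..b, f y * (y - c)
      = (∫ y in (0 : ℝ)..b, f y * y) - c * ∫ y in (0 : ℝ)..b, f y := by
    intro b
    rw [← intervalIntegral.integral_const_mul, ← intervalIntegral.integral_sub
      (Continuous.intervalIntegrable (by fun_prop) 0 b) ((hf.const_mul c).intervalIntegrable 0 b)]
    congr 1 with y
    ring
  have hint : ∀ b d : ℝ, IntervalIntegrable (fun y => f y * (y - c)) volume b d :=
    fun b d => (hf.mul (continuous_id.sub continuous_const)).intervalIntegrable b d
  rw [← sub_nonpos, ← hdiff]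
  rcases le_total a c with hac | hca
  · have h : 0 ≤ ∫ y in (0 : ℝ)..a, -(f y * (y - c)) :=
      intervalIntegral.integral_nonneg ha.1 fun y hy => neg_nonneg.2 <|
        mul_nonpos_of_nonneg_of_nonpos (hnonneg y ⟨hy.1, hy.2.trans ha.2⟩)
          (sub_nonpos.2 (hy.2.trans hac))
    rw [intervalIntegral.integral_neg] at h
    linarith
  · have h : 0 ≤ ∫ y in a..1, f y * (y - c) :=
      intervalIntegral.integral_nonneg ha.2 fun y hy =>
        mul_nonneg (hnonneg y ⟨ha.1.trans hy.1, hy.2⟩) (sub_nonneg.2 (hca.trans hy.1))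
    have hadd := intervalIntegral.integral_add_adjacent_intervals (hint 0 a) (hint a 1)
    rw [hdiff 1, hc, sub_self] at hadd
    linarith

theorem integral_comp_abs_sub {f : ℝ → ℝ} (hf : Continuous f) {x : ℝ}
    (hx : x ∈ Set.Icc (0 : ℝ) 1) :
    ∫ z in (0 : ℝ)..1, f |z - x| = (∫ y in (0 : ℝ)..x, f y) + ∫ y in (0 : ℝ)..(1 - x), f y := by
  have hcont : Continuous fun z => f |z - x| := by fun_prop
  rw [← intervalIntegral.integral_add_adjacent_intervals
    (hcont.intervalIntegrable 0 x) (hcont.intervalIntegrable x 1)]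
  congr 1
  · rw [intervalIntegral.integral_congr (g := fun z => f (x - z)),
      intervalIntegral.integral_comp_sub_left, sub_self, sub_zero]
    intro z hz
    rw [Set.uIcc_of_le hx.1] at hz
    simp only [abs_of_nonpos (sub_nonpos.2 hz.2), neg_sub]
  · rw [intervalIntegral.integral_congr (g := fun z => f (z - x)),
      intervalIntegral.integral_comp_sub_right, sub_self]
    intro z hz
    rw [Set.uIcc_of_le hx.2] at hz
    simp only [abs_of_nonneg (sub_nonneg.2 hz.1)]

/-- `∫_0^1 φ_k(|z-x|) |z-x| dz ≤ (2/3)^{k+1} ∫_0^1 φ_k(|z-x|) dz`. -/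
theorem integral_phiUF_weighted_bound (k : ℕ) (x : ℝ) (hx : x ∈ Set.Icc (0 : ℝ) 1) :
    (∫ z in (0 : ℝ)..1, phiUF k |z - x| * |z - x|)
      ≤ (2 / 3 : ℝ) ^ (k + 1) * ∫ z in (0 : ℝ)..1, phiUF k |z - x| := by
  have hφ := continuous_phiUF k
  have hx' : 1 - x ∈ Set.Icc (0 : ℝ) 1 := ⟨by linarith [hx.2], by linarith [hx.1]⟩
  have hmean : ∫ y in (0 : ℝ)..1, phiUF k y * y
      = (2 / 3 : ℝ) ^ k / 2 * ∫ y in (0 : ℝ)..1, phiUF k y := by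
    have h₀ := integral_pow_mul_phiUF 0 k
    have h₁ := integral_pow_mul_phiUF 1 k
    simp only [pow_zero, pow_one, mul_comm _ (phiUF k _), mul_one] at h₀ h₁
    rw [h₀, h₁, div_pow]
    norm_num
    field_simp
  have hle : ∀ a ∈ Set.Icc (0 : ℝ) 1, ∫ y in (0 : ℝ)..a, phiUF k y * y
      ≤ (2 / 3 : ℝ) ^ (k + 1) * ∫ y in (0 : ℝ)..a, phiUF k y := by
    intro a ha
    refine (integral_mul_self_le_of_integral_mul_self_eq hφ (fun y => phiUF_nonneg k) hmean
      ha).trans (mul_le_mul_of_nonneg_right ?_ ?_)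
    · have : (0 : ℝ) < (2 / 3) ^ k := by positivity
      rw [pow_succ]
      linarith
    · exact intervalIntegral.integral_nonneg ha.1 fun y hy =>
        phiUF_nonneg k ⟨hy.1, hy.2.trans ha.2⟩
  rw [integral_comp_abs_sub (f := fun y => phiUF k y * y) (hφ.mul continuous_id) hx,
    integral_comp_abs_sub hφ hx, mul_add]
  exact add_le_add (hle x hx) (hle (1 - x) hx')
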